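/- (Lemma 4.5) Let λ ∈ ℝ, ε ∈ (0,1), Û ∈ ℋ, and let U = (φ,Φ,ψ,Ψ,θ,η,ξ,ζ) ∈ D(𝒜) satisfy the resolvent equation iλU − 𝒜U = Û. Then ρ1‖Φ‖² + ρ2‖Ψ‖² ≤ cε‖U‖²_ℋ + c‖U‖_ℋ[‖φx+ψ‖ + ‖ψx‖] + (c/ε³)‖U‖_ℋ ‖Û‖_ℋ for some structural constant c > 0 independent of λ, ε, U and Û. -/

import Mathlib

/-!
Shared setting: thermoelastic Timoshenko–Gurtin–Pipkin system on (0,L),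
history space framework of Dafermos.  Functions on (0,L) are represented as
maps `ℝ → ℂ`, memory variables as maps `ℝ → ℝ → ℂ` (first argument the
history variable `s`, second the space variable `x`).
-/

open MeasureTheory Set Filter

noncomputable section

namespace TGP

/-- L² norm squared on (0,L). -/
def L2normSq (L : ℝ) (f : ℝ → ℂ) : ℝ := ∫ x in Ioo 0 L, ‖f x‖ ^ 2

/-- L² norm on (0,L). -/
def L2norm (L : ℝ) (f : ℝ → ℂ) : ℝ := Real.sqrt (L2normSq L f)

/-- L² inner product on (0,L). -/
def L2inner (L : ℝ) (f g : ℝ → ℂ) : ℂ :=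
  ∫ x in Ioo 0 L, (starRingEnd ℂ) (g x) * f x

/-- Weighted memory-space norm squared: `∫₀^∞ w(s) ‖ηx(s)‖² ds`. -/
def MnormSq (L : ℝ) (w : ℝ → ℝ) (η : ℝ → ℝ → ℂ) : ℝ :=
  ∫ s in Ioi (0 : ℝ), w s * L2normSq L (deriv (η s))

/-- Weighted memory-space norm. -/
def Mnorm (L : ℝ) (w : ℝ → ℝ) (η : ℝ → ℝ → ℂ) : ℝ := Real.sqrt (MnormSq L w η)

/-- Weighted memory-space inner product: `∫₀^∞ w(s) ⟨η1x(s), η2x(s)⟩ ds`. -/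
def Minner (L : ℝ) (w : ℝ → ℝ) (η1 η2 : ℝ → ℝ → ℂ) : ℂ :=
  ∫ s in Ioi (0 : ℝ), (w s : ℂ) * L2inner L (deriv (η1 s)) (deriv (η2 s))

/-- The functional `Γ[η] = ∫₀^∞ (−w'(s)) ‖ηx(s)‖² ds`. -/
def Gam (L : ℝ) (w : ℝ → ℝ) (η : ℝ → ℝ → ℂ) : ℝ :=
  ∫ s in Ioi (0 : ℝ), (-(deriv w s)) * L2normSq L (deriv (η s))

/-- Structural parameters of the model, including the assumptions on the
memory kernels μ and ν. -/
structure Params where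
  L : ℝ
  rho1 : ℝ
  rho2 : ℝ
  rho3 : ℝ
  rho4 : ℝ
  k : ℝ
  b : ℝ
  gamma : ℝ
  sigma : ℝ
  w1 : ℝ
  w2 : ℝ
  delta1 : ℝ
  delta2 : ℝ
  mu : ℝ → ℝ
  nu : ℝ → ℝ
  hL : 0 < L
  hrho1 : 0 < rho1
  hrho2 : 0 < rho2
  hrho3 : 0 < rho3
  hrho4 : 0 < rho4
  hk : 0 < k
  hb : 0 < b
  hgamma : 0 < gamma
  hsigma : 0 < sigma
  hw1 : 0 < w1
  hw2 : 0 < w2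
  hdelta1 : 0 < delta1
  hdelta2 : 0 < delta2
  hmu_nonneg : ∀ s ∈ Ioi (0 : ℝ), 0 ≤ mu s
  hnu_nonneg : ∀ s ∈ Ioi (0 : ℝ), 0 ≤ nu s
  hmu_mono : AntitoneOn mu (Ioi 0)
  hnu_mono : AntitoneOn nu (Ioi 0)
  hmu_int : IntegrableOn mu (Ioi 0)
  hnu_int : IntegrableOn nu (Ioi 0)
  -- absolute continuity on (0,∞), expressed through the fundamental
  -- theorem of calculus for the a.e. derivative
  hmu_ac : ∀ a c : ℝ, 0 < a → a ≤ c → mu c - mu a = ∫ s in a..c, deriv mu s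
  hnu_ac : ∀ a c : ℝ, 0 < a → a ≤ c → nu c - nu a = ∫ s in a..c, deriv nu s
  -- the Dafermos conditions μ' + δ₁ μ ≤ 0, ν' + δ₂ ν ≤ 0 a.e.
  hmu_daf : ∀ᵐ s ∂(volume.restrict (Ioi (0 : ℝ))), deriv mu s + delta1 * mu s ≤ 0
  hnu_daf : ∀ᵐ s ∂(volume.restrict (Ioi (0 : ℝ))), deriv nu s + delta2 * nu s ≤ 0

/-- The two kinds of boundary conditions considered. -/
inductive BC
  | mixed     -- mixed Dirichlet–Neumann boundary conditions
  | dirichlet -- full Dirichlet boundary conditions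

/-- A state `U = (φ, Φ, ψ, Ψ, θ, η, ξ, ζ)`. -/
structure State where
  phi : ℝ → ℂ
  Phi : ℝ → ℂ
  psi : ℝ → ℂ
  Psi : ℝ → ℂ
  theta : ℝ → ℂ
  eta : ℝ → ℝ → ℂ
  xi : ℝ → ℂ
  zeta : ℝ → ℝ → ℂ

instance : Sub State :=
  ⟨fun U V =>
    { phi := U.phi - V.phi
      Phi := U.Phi - V.Phi
      psi := U.psi - V.psi
      Psi := U.Psi - V.Psi
      theta := U.theta - V.theta
      eta := fun s => U.eta s - V.eta s
      xi := U.xi - V.xi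
      zeta := fun s => U.zeta s - V.zeta s }⟩

instance : SMul ℂ State :=
  ⟨fun a U =>
    { phi := a • U.phi
      Phi := a • U.Phi
      psi := a • U.psi
      Psi := a • U.Psi
      theta := a • U.theta
      eta := fun s => a • U.eta s
      xi := a • U.xi
      zeta := fun s => a • U.zeta s }⟩

/-- Membership in L²(0,L). -/
def memL2 (L : ℝ) (f : ℝ → ℂ) : Prop :=
  AEStronglyMeasurable f (volume.restrict (Ioo 0 L)) ∧
  IntegrableOn (fun x => ‖f x‖ ^ 2) (Ioo 0 L)

/-- Zero mean value on (0,L) (membership in L²_*). -/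
def zeroMean (L : ℝ) (f : ℝ → ℂ) : Prop := (∫ x in Ioo 0 L, f x) = 0

/-- Membership in H¹(0,L). -/
def memH1 (L : ℝ) (f : ℝ → ℂ) : Prop :=
  ContinuousOn f (Icc 0 L) ∧ (∀ x ∈ Ioo 0 L, DifferentiableAt ℝ f x) ∧
  memL2 L f ∧ memL2 L (deriv f)

/-- Membership in H¹₀(0,L). -/
def memH10 (L : ℝ) (f : ℝ → ℂ) : Prop := memH1 L f ∧ f 0 = 0 ∧ f L = 0

/-- Membership in H¹_*(0,L) = H¹ ∩ L²_*. -/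
def memH1star (L : ℝ) (f : ℝ → ℂ) : Prop := memH1 L f ∧ zeroMean L f

/-- Membership in H²(0,L). -/
def memH2 (L : ℝ) (f : ℝ → ℂ) : Prop := memH1 L f ∧ memH1 L (deriv f)

/-- Membership in the memory space ℳ = L²_μ((0,∞); H¹_*) (mixed case) or
ℳ = L²_μ((0,∞); H¹₀) (Dirichlet case). -/
def memMS (P : Params) (bc : BC) (η : ℝ → ℝ → ℂ) : Prop :=
  (∀ s ∈ Ioi (0 : ℝ),
    match bc with
    | BC.mixed => memH1star P.L (η s)
    | BC.dirichlet => memH10 P.L (η s)) ∧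
  IntegrableOn (fun s => P.mu s * L2normSq P.L (deriv (η s))) (Ioi 0)

/-- Membership in the memory space 𝒩 = L²_ν((0,∞); H¹₀). -/
def memNS (P : Params) (ζ : ℝ → ℝ → ℂ) : Prop :=
  (∀ s ∈ Ioi (0 : ℝ), memH10 P.L (ζ s)) ∧
  IntegrableOn (fun s => P.nu s * L2normSq P.L (deriv (ζ s))) (Ioi 0)

/-- Derivative with respect to the history variable s. -/
def sDeriv (η : ℝ → ℝ → ℂ) : ℝ → ℝ → ℂ := fun s x => deriv (fun r => η r x) s

/-- The generator `T = −∂s` of the right-translation semigroup. -/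
def Top (η : ℝ → ℝ → ℂ) : ℝ → ℝ → ℂ := fun s x => -(sDeriv η s x)

/-- Membership in D(T) ⊂ ℳ : η' ∈ ℳ and ‖ηx(s)‖ → 0 as s → 0⁺. -/
def memDTM (P : Params) (bc : BC) (η : ℝ → ℝ → ℂ) : Prop :=
  memMS P bc η ∧ memMS P bc (sDeriv η) ∧
  Tendsto (fun s => L2norm P.L (deriv (η s))) (nhdsWithin 0 (Ioi 0)) (nhds 0)

/-- Membership in D(T) ⊂ 𝒩 : ζ' ∈ 𝒩 and ‖ζx(s)‖ → 0 as s → 0⁺. -/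
def memDTN (P : Params) (ζ : ℝ → ℝ → ℂ) : Prop :=
  memNS P ζ ∧ memNS P (sDeriv ζ) ∧
  Tendsto (fun s => L2norm P.L (deriv (ζ s))) (nhdsWithin 0 (Ioi 0)) (nhds 0)

/-- Membership in the state space ℋ. -/
def memHS (P : Params) (bc : BC) (U : State) : Prop :=
  memH10 P.L U.phi ∧ memL2 P.L U.Phi ∧
  (match bc with
   | BC.mixed =>
      memH1star P.L U.psi ∧ memL2 P.L U.Psi ∧ zeroMean P.L U.Psi ∧
      memL2 P.L U.theta ∧ zeroMean P.L U.theta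
   | BC.dirichlet =>
      memH10 P.L U.psi ∧ memL2 P.L U.Psi ∧ memL2 P.L U.theta) ∧
  memMS P bc U.eta ∧ memL2 P.L U.xi ∧ memNS P U.zeta

/-- The squared norm on ℋ. -/
def hnormSq (P : Params) (U : State) : ℝ :=
  P.k * L2normSq P.L (fun x => deriv U.phi x + U.psi x) +
  P.rho1 * L2normSq P.L U.Phi +
  P.b * L2normSq P.L (deriv U.psi) +
  P.rho2 * L2normSq P.L U.Psi +
  P.rho3 * L2normSq P.L U.theta +
  P.w1 * MnormSq P.L P.mu U.eta +
  P.rho4 * L2normSq P.L U.xi +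
  P.w2 * MnormSq P.L P.nu U.zeta

/-- The norm on ℋ. -/
def hnorm (P : Params) (U : State) : ℝ := Real.sqrt (hnormSq P U)

/-- The inner product on ℋ. -/
def hinner (P : Params) (U V : State) : ℂ :=
  (P.k : ℂ) * L2inner P.L (fun x => deriv U.phi x + U.psi x)
      (fun x => deriv V.phi x + V.psi x) +
  (P.rho1 : ℂ) * L2inner P.L U.Phi V.Phi +
  (P.b : ℂ) * L2inner P.L (deriv U.psi) (deriv V.psi) +
  (P.rho2 : ℂ) * L2inner P.L U.Psi V.Psi +
  (P.rho3 : ℂ) * L2inner P.L U.theta V.theta +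
  (P.w1 : ℂ) * Minner P.L P.mu U.eta V.eta +
  (P.rho4 : ℂ) * L2inner P.L U.xi V.xi +
  (P.w2 : ℂ) * Minner P.L P.nu U.zeta V.zeta

/-- `x ↦ ∫₀^∞ μ(s) η(s,x) ds`. -/
def muInt (P : Params) (η : ℝ → ℝ → ℂ) : ℝ → ℂ :=
  fun x => ∫ s in Ioi (0 : ℝ), (P.mu s : ℂ) * η s x

/-- `x ↦ ∫₀^∞ ν(s) ζ(s,x) ds`. -/
def nuInt (P : Params) (ζ : ℝ → ℝ → ℂ) : ℝ → ℂ :=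
  fun x => ∫ s in Ioi (0 : ℝ), (P.nu s : ℂ) * ζ s x

/-- The Timoshenko–Gurtin–Pipkin operator 𝒜. -/
def Aop (P : Params) (U : State) : State where
  phi := U.Phi
  Phi := fun x =>
    ((P.k / P.rho1 : ℝ) : ℂ) * deriv (fun y => deriv U.phi y + U.psi y) x -
    ((P.gamma / P.rho1 : ℝ) : ℂ) * deriv U.theta x
  psi := U.Psi
  Psi := fun x =>
    ((P.b / P.rho2 : ℝ) : ℂ) * deriv (deriv U.psi) x -
    ((P.k / P.rho2 : ℝ) : ℂ) * (deriv U.phi x + U.psi x) +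
    ((P.gamma / P.rho2 : ℝ) : ℂ) * U.theta x -
    ((P.sigma / P.rho2 : ℝ) : ℂ) * deriv U.xi x
  theta := fun x =>
    ((P.w1 / P.rho3 : ℝ) : ℂ) *
      (∫ s in Ioi (0 : ℝ), (P.mu s : ℂ) * deriv (deriv (U.eta s)) x) -
    ((P.gamma / P.rho3 : ℝ) : ℂ) * (deriv U.Phi x + U.Psi x)
  eta := fun s x => Top U.eta s x + U.theta x
  xi := fun x =>
    ((P.w2 / P.rho4 : ℝ) : ℂ) *
      (∫ s in Ioi (0 : ℝ), (P.nu s : ℂ) * deriv (deriv (U.zeta s)) x) -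
    ((P.sigma / P.rho4 : ℝ) : ℂ) * deriv U.Psi x
  zeta := fun s x => Top U.zeta s x + U.xi x

/-- The domain D(𝒜) of the operator 𝒜. -/
def memDomA (P : Params) (bc : BC) (U : State) : Prop :=
  memHS P bc U ∧ memH2 P.L U.phi ∧ memH10 P.L U.Phi ∧ memH10 P.L U.xi ∧
  memH2 P.L (nuInt P U.zeta) ∧ memDTM P bc U.eta ∧ memDTN P U.zeta ∧
  (match bc with
   | BC.mixed =>
      memH10 P.L (deriv U.psi) ∧
      memH10 P.L (fun x => ∫ s in Ioi (0 : ℝ), (P.mu s : ℂ) * deriv (U.eta s) x) ∧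
      memH1star P.L U.Psi ∧ memH1star P.L U.theta
   | BC.dirichlet =>
      memH2 P.L U.psi ∧ memH10 P.L U.Psi ∧ memH10 P.L U.theta ∧
      memH2 P.L (muInt P U.eta))

/-- a.e. equality on (0,L). -/
def aeeqL (L : ℝ) (f g : ℝ → ℂ) : Prop :=
  ∀ᵐ x ∂(volume.restrict (Ioo 0 L)), f x = g x

/-- Equality of two states as elements of ℋ (componentwise, in the respective
norms of the factor spaces). -/
def StateEqAE (P : Params) (U V : State) : Prop :=
  aeeqL P.L (fun x => deriv U.phi x + U.psi x) (fun x => deriv V.phi x + V.psi x) ∧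
  aeeqL P.L U.Phi V.Phi ∧
  aeeqL P.L (deriv U.psi) (deriv V.psi) ∧
  aeeqL P.L U.Psi V.Psi ∧
  aeeqL P.L U.theta V.theta ∧
  (∀ᵐ s ∂(volume.restrict (Ioi (0 : ℝ))), aeeqL P.L (deriv (U.eta s)) (deriv (V.eta s))) ∧
  aeeqL P.L U.xi V.xi ∧
  (∀ᵐ s ∂(volume.restrict (Ioi (0 : ℝ))), aeeqL P.L (deriv (U.zeta s)) (deriv (V.zeta s)))

/-- The resolvent equation `iλU − 𝒜U = Û` (equality in ℋ). -/
def resolventEq (P : Params) (lam : ℝ) (U Uhat : State) : Prop :=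
  StateEqAE P (((Complex.I * (lam : ℂ)) • U) - Aop P U) Uhat

/-- `α(x) = ∫₀^∞ μ(s) ηx(x,s) ds`. -/
def alphaF (P : Params) (U : State) : ℝ → ℂ :=
  fun x => ∫ s in Ioi (0 : ℝ), (P.mu s : ℂ) * deriv (U.eta s) x

/-- `β(x) = ∫₀^∞ ν(s) ζx(x,s) ds`. -/
def betaF (P : Params) (U : State) : ℝ → ℂ :=
  fun x => ∫ s in Ioi (0 : ℝ), (P.nu s : ℂ) * deriv (U.zeta s) x

/-- `𝒫(φ,ψ,α) = |α(L)||φx(L)+ψ(L)| + |α(0)||φx(0)+ψ(0)|`. -/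
def Pterm (P : Params) (U : State) : ℝ :=
  ‖alphaF P U P.L‖ * ‖deriv U.phi P.L + U.psi P.L‖ +
  ‖alphaF P U 0‖ * ‖deriv U.phi 0 + U.psi 0‖

/-- `𝒬(ψ,β) = |β(L)||ψx(L)| + |β(0)||ψx(0)|`. -/
def Qterm (P : Params) (U : State) : ℝ :=
  ‖betaF P U P.L‖ * ‖deriv U.psi P.L‖ + ‖betaF P U 0‖ * ‖deriv U.psi 0‖

/-- `𝓘(φ,ψ) = |φx(0)+ψ(0)|² + |φx(L)+ψ(L)|²`. -/
def Iterm (P : Params) (U : State) : ℝ :=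
  ‖deriv U.phi 0 + U.psi 0‖ ^ 2 + ‖deriv U.phi P.L + U.psi P.L‖ ^ 2

/-- `𝓙(ψ) = |ψx(0)|² + |ψx(L)|²`. -/
def Jterm (P : Params) (U : State) : ℝ :=
  ‖deriv U.psi 0‖ ^ 2 + ‖deriv U.psi P.L‖ ^ 2

/-- `S` is the contraction C₀-semigroup on ℋ generated by 𝒜. -/
def IsGenSemigroup (P : Params) (bc : BC) (S : ℝ → State → State) : Prop :=
  (∀ t, 0 ≤ t → ∀ U, memHS P bc U → memHS P bc (S t U)) ∧
  (∀ U, memHS P bc U → StateEqAE P (S 0 U) U) ∧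
  (∀ t s, 0 ≤ t → 0 ≤ s → ∀ U, memHS P bc U →
    StateEqAE P (S (t + s) U) (S t (S s U))) ∧
  (∀ t, 0 ≤ t → ∀ U, memHS P bc U → hnorm P (S t U) ≤ hnorm P U) ∧
  (∀ U, memHS P bc U →
    Tendsto (fun t => hnorm P (S t U - U)) (nhdsWithin 0 (Ioi 0)) (nhds 0)) ∧
  (∀ U, memDomA P bc U → ∀ t, 0 ≤ t → memDomA P bc (S t U) ∧
    Tendsto (fun h : ℝ =>
        hnorm P (((h⁻¹ : ℝ) : ℂ) • (S (t + h) U - S t U) - Aop P (S t U)))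
      (nhdsWithin 0 (Ioi 0)) (nhds 0))

/-- Continuity on [0,∞) with values in ℋ. -/
def ContH (P : Params) (F : ℝ → State) : Prop :=
  ∀ t, 0 ≤ t →
    Tendsto (fun r => hnorm P (F r - F t)) (nhdsWithin t (Ici 0)) (nhds 0)

/-- `G` is the (right) derivative of `F` on [0,∞) in the norm of ℋ. -/
def HasHDeriv (P : Params) (F G : ℝ → State) : Prop :=
  ∀ t, 0 ≤ t →
    Tendsto (fun h : ℝ =>
        hnorm P (((h⁻¹ : ℝ) : ℂ) • (F (t + h) - F t) - G t))
      (nhdsWithin 0 (Ioi 0)) (nhds 0)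

/-- `F ∈ Cᵏ([0,∞), ℋ)`. -/
def CkH (P : Params) : ℕ → (ℝ → State) → Prop
  | 0, F => ContH P F
  | (n + 1), F => ContH P F ∧ ∃ G, HasHDeriv P F G ∧ CkH P n G

/-- Membership in D(𝒜ⁿ). -/
def memDomIter (P : Params) (bc : BC) : ℕ → State → Prop
  | 0, U => memHS P bc U
  | (n + 1), U => memDomA P bc U ∧ memDomIter P bc n (Aop P U)

theorem memL2_iff_memLp {L : ℝ} {f : ℝ → ℂ} :
    memL2 L f ↔ MemLp f 2 (volume.restrict (Ioo 0 L)) :=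
  ⟨fun h => (memLp_two_iff_integrable_sq_norm h.1).2 h.2,
    fun h => ⟨h.1, (memLp_two_iff_integrable_sq_norm h.1).1 h⟩⟩

theorem memL2.integrable {L : ℝ} {f : ℝ → ℂ} (h : memL2 L f) : IntegrableOn f (Ioo 0 L) :=
  (memL2_iff_memLp.1 h).integrable (by norm_num)

theorem memL2.add {L : ℝ} {f g : ℝ → ℂ} (hf : memL2 L f) (hg : memL2 L g) : memL2 L (f + g) :=
  memL2_iff_memLp.2 ((memL2_iff_memLp.1 hf).add (memL2_iff_memLp.1 hg))

theorem memL2.sub {L : ℝ} {f g : ℝ → ℂ} (hf : memL2 L f) (hg : memL2 L g) : memL2 L (f - g) :=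
  memL2_iff_memLp.2 ((memL2_iff_memLp.1 hf).sub (memL2_iff_memLp.1 hg))

theorem memL2.const_smul {L : ℝ} {f : ℝ → ℂ} (hf : memL2 L f) (a : ℂ) : memL2 L (a • f) :=
  memL2_iff_memLp.2 ((memL2_iff_memLp.1 hf).const_smul a)

theorem memL2.congr {L : ℝ} {f g : ℝ → ℂ} (hf : memL2 L f) (h : aeeqL L f g) : memL2 L g :=
  memL2_iff_memLp.2 ((memLp_congr_ae h).1 (memL2_iff_memLp.1 hf))

theorem memL2.integrable_mul {L : ℝ} {f g : ℝ → ℂ} (hf : memL2 L f) (hg : memL2 L g) :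
    IntegrableOn (fun x => f x * g x) (Ioo 0 L) :=
  (memL2_iff_memLp.1 hf).integrable_mul (memL2_iff_memLp.1 hg)

theorem memL2.conj {L : ℝ} {f : ℝ → ℂ} (hf : memL2 L f) :
    memL2 L (fun x => (starRingEnd ℂ) (f x)) :=
  ⟨Complex.continuous_conj.comp_aestronglyMeasurable hf.1, by simpa using hf.2⟩

theorem memL2.integrable_norm_mul {L : ℝ} {f g : ℝ → ℂ} (hf : memL2 L f) (hg : memL2 L g) :
    IntegrableOn (fun x => ‖f x‖ * ‖g x‖) (Ioo 0 L) := by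
  refine (hf.integrable_mul hg).norm.congr (Eventually.of_forall fun x => ?_)
  exact norm_mul _ _

theorem L2normSq_nonneg (L : ℝ) (f : ℝ → ℂ) : 0 ≤ L2normSq L f :=
  integral_nonneg fun _ => by positivity

theorem L2norm_nonneg (L : ℝ) (f : ℝ → ℂ) : 0 ≤ L2norm L f := Real.sqrt_nonneg _

theorem L2norm_congr {L : ℝ} {f g : ℝ → ℂ} (h : aeeqL L f g) : L2norm L f = L2norm L g := by
  have h' : (fun x => ‖f x‖ ^ 2) =ᵐ[volume.restrict (Ioo 0 L)] fun x => ‖g x‖ ^ 2 :=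
    h.mono fun x hx => by simp only [hx]
  rw [L2norm, L2norm, L2normSq, L2normSq, integral_congr_ae h']

theorem ofReal_L2norm {L : ℝ} {f : ℝ → ℂ} (hf : memL2 L f) :
    ENNReal.ofReal (L2norm L f) = eLpNorm f 2 (volume.restrict (Ioo 0 L)) := by
  rw [(memL2_iff_memLp.1 hf).eLpNorm_eq_integral_rpow_norm (by norm_num) (by norm_num)]
  simp [L2norm, L2normSq, Real.sqrt_eq_rpow]

theorem L2norm_add_le {L : ℝ} {f g : ℝ → ℂ} (hf : memL2 L f) (hg : memL2 L g) :
    L2norm L (f + g) ≤ L2norm L f + L2norm L g := by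
  rw [← ENNReal.ofReal_le_ofReal_iff (add_nonneg (L2norm_nonneg _ _) (L2norm_nonneg _ _)),
    ENNReal.ofReal_add (L2norm_nonneg _ _) (L2norm_nonneg _ _), ofReal_L2norm hf,
    ofReal_L2norm hg, ofReal_L2norm (hf.add hg)]
  exact eLpNorm_add_le hf.1 hg.1 (by norm_num)

theorem L2norm_le_add_of_add {L : ℝ} {f g : ℝ → ℂ} (hf : memL2 L f) (hg : memL2 L g) :
    L2norm L f ≤ L2norm L (f + g) + L2norm L g := by
  have h := L2norm_add_le (hf.add hg) (hg.const_smul (-1))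
  have h1 : f + g + (-1 : ℂ) • g = f := by ext x; simp
  have h2 : L2norm L ((-1 : ℂ) • g) = L2norm L g := by simp [L2norm, L2normSq]
  rwa [h1, h2] at h

theorem integral_norm_mul_le {L : ℝ} {f g : ℝ → ℂ} (hf : memL2 L f) (hg : memL2 L g) :
    ∫ x in Ioo 0 L, ‖f x‖ * ‖g x‖ ≤ L2norm L f * L2norm L g := by
  have h := integral_mul_norm_le_Lp_mul_Lq (μ := volume.restrict (Ioo 0 L)) (f := f) (g := g)
    Real.HolderConjugate.two_two (by simpa using memL2_iff_memLp.1 hf)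
    (by simpa using memL2_iff_memLp.1 hg)
  simpa [L2norm, L2normSq, Real.sqrt_eq_rpow] using h

/-- `F` is integrable on `(0,L)` with integral at most `C`. -/
def IntegralBound (L : ℝ) (F : ℝ → ℝ) (C : ℝ) : Prop :=
  IntegrableOn F (Ioo 0 L) ∧ ∫ x in Ioo 0 L, F x ≤ C

theorem IntegralBound.add {L : ℝ} {F G : ℝ → ℝ} {C D : ℝ} (hF : IntegralBound L F C)
    (hG : IntegralBound L G D) : IntegralBound L (fun x => F x + G x) (C + D) :=
  ⟨hF.1.add hG.1, by rw [integral_add hF.1 hG.1]; exact add_le_add hF.2 hG.2⟩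

theorem integralBound_norm_mul {L a : ℝ} (ha : 0 ≤ a) {f g : ℝ → ℂ} (hf : memL2 L f)
    (hg : memL2 L g) :
    IntegralBound L (fun x => a * (‖f x‖ * ‖g x‖)) (a * (L2norm L f * L2norm L g)) :=
  ⟨(hf.integrable_norm_mul hg).const_mul a, by
    rw [integral_const_mul]
    exact mul_le_mul_of_nonneg_left (integral_norm_mul_le hf hg) ha⟩

theorem memL2_one (L : ℝ) : memL2 L (fun _ => 1) :=
  memL2_iff_memLp.2 (memLp_const 1)

theorem memH1.const_smul {L : ℝ} {f : ℝ → ℂ} (hf : memH1 L f) (a : ℂ) : memH1 L (a • f) := by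
  refine ⟨hf.1.const_smul a, fun x hx => (hf.2.1 x hx).const_smul a, hf.2.2.1.const_smul a,
    (hf.2.2.2.const_smul a).congr ?_⟩
  filter_upwards [ae_restrict_mem measurableSet_Ioo] with x hx
  exact (deriv_const_smul a (hf.2.1 x hx)).symm

theorem memH1.sub {L : ℝ} {f g : ℝ → ℂ} (hf : memH1 L f) (hg : memH1 L g) :
    memH1 L (f - g) := by
  refine ⟨hf.1.sub hg.1, fun x hx => (hf.2.1 x hx).sub (hg.2.1 x hx), hf.2.2.1.sub hg.2.2.1,
    (hf.2.2.2.sub hg.2.2.2).congr ?_⟩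
  filter_upwards [ae_restrict_mem measurableSet_Ioo] with x hx
  exact (deriv_sub (hf.2.1 x hx) (hg.2.1 x hx)).symm

theorem memH1.add {L : ℝ} {f g : ℝ → ℂ} (hf : memH1 L f) (hg : memH1 L g) :
    memH1 L (f + g) := by
  simpa [sub_eq_add_neg] using hf.sub (hg.const_smul (-1))

theorem memH10.const_smul {L : ℝ} {f : ℝ → ℂ} (hf : memH10 L f) (a : ℂ) : memH10 L (a • f) :=
  ⟨hf.1.const_smul a, by simp [hf.2.1], by simp [hf.2.2]⟩

theorem memH10.sub {L : ℝ} {f g : ℝ → ℂ} (hf : memH10 L f) (hg : memH10 L g) :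
    memH10 L (f - g) :=
  ⟨hf.1.sub hg.1, by simp [hf.2.1, hg.2.1], by simp [hf.2.2, hg.2.2]⟩

theorem memH1star.const_smul {L : ℝ} {f : ℝ → ℂ} (hf : memH1star L f) (a : ℂ) :
    memH1star L (a • f) :=
  ⟨hf.1.const_smul a, by
    have h : (∫ x in Ioo 0 L, f x) = 0 := hf.2
    simp [zeroMean, integral_const_mul, h]⟩

theorem memH1star.sub {L : ℝ} {f g : ℝ → ℂ} (hf : memH1star L f) (hg : memH1star L g) :
    memH1star L (f - g) :=
  ⟨hf.1.sub hg.1, by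
    have h : (∫ x in Ioo 0 L, f x) = 0 := hf.2
    have h' : (∫ x in Ioo 0 L, g x) = 0 := hg.2
    unfold zeroMean
    simp only [Pi.sub_apply]
    rw [integral_sub hf.1.2.2.1.integrable hg.1.2.2.1.integrable, h, h', sub_zero]⟩

theorem integral_Ioo_eq_sub {L : ℝ} (hL : 0 ≤ L) {F F' : ℝ → ℂ} (hc : ContinuousOn F (Icc 0 L))
    (hd : ∀ x ∈ Ioo 0 L, HasDerivAt F (F' x) x) (hi : IntegrableOn F' (Ioo 0 L)) :
    ∫ x in Ioo 0 L, F' x = F L - F 0 := by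
  rw [← intervalIntegral.integral_eq_sub_of_hasDerivAt_of_le hL hc hd
    ((intervalIntegrable_iff_integrableOn_Ioo_of_le hL).2 hi),
    intervalIntegral.integral_of_le hL, integral_Ioc_eq_integral_Ioo]

theorem memH1.norm_sub_le {L : ℝ} {f : ℝ → ℂ} (hf : memH1 L f) {x y : ℝ}
    (hx : x ∈ Icc 0 L) (hy : y ∈ Icc 0 L) :
    ‖f x - f y‖ ≤ Real.sqrt L * L2norm L (deriv f) := by
  wlog hyx : y ≤ x generalizing x y
  · rw [norm_sub_rev]
    exact this hy hx (le_of_not_ge hyx)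
  have hL : 0 ≤ L := hx.1.trans hx.2
  have hsub : Ioo y x ⊆ Ioo 0 L := Ioo_subset_Ioo hy.1 hx.2
  have hone : L2norm L (fun _ => 1) = Real.sqrt L := by
    simp [L2norm, L2normSq, hL]
  have hcs := integral_norm_mul_le hf.2.2.2 (memL2_one L)
  rw [hone] at hcs
  simp only [norm_one, mul_one] at hcs
  rw [← intervalIntegral.integral_eq_sub_of_hasDerivAt_of_le hyx
    (hf.1.mono (Icc_subset_Icc hy.1 hx.2)) (fun z hz => (hf.2.1 z (hsub hz)).hasDerivAt)
    ((intervalIntegrable_iff_integrableOn_Ioo_of_le hyx).2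
      (hf.2.2.2.integrable.mono_set hsub)),
    intervalIntegral.integral_of_le hyx, integral_Ioc_eq_integral_Ioo]
  calc ‖∫ z in Ioo y x, deriv f z‖ ≤ ∫ z in Ioo y x, ‖deriv f z‖ :=
        norm_integral_le_integral_norm _
    _ ≤ ∫ z in Ioo 0 L, ‖deriv f z‖ :=
        setIntegral_mono_set hf.2.2.2.integrable.norm
          (Eventually.of_forall fun _ => norm_nonneg _) hsub.eventuallyLE
    _ ≤ Real.sqrt L * L2norm L (deriv f) := by rwa [mul_comm]

theorem L2norm_le_of_norm_le {L C : ℝ} (hL : 0 ≤ L) (hC : 0 ≤ C) {f : ℝ → ℂ}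
    (hb : ∀ x ∈ Ioo 0 L, ‖f x‖ ≤ Real.sqrt L * C) :
    L2norm L f ≤ L * C := by
  refine Real.sqrt_le_iff.2 ⟨mul_nonneg hL hC, ?_⟩
  have h : L2normSq L f ≤ ∫ _ in Ioo 0 L, L * C ^ 2 := by
    refine integral_mono_of_nonneg (Eventually.of_forall fun _ => by positivity)
      (integrable_const _) ?_
    filter_upwards [ae_restrict_mem measurableSet_Ioo] with x hx
    calc ‖f x‖ ^ 2 ≤ (Real.sqrt L * C) ^ 2 := by gcongr; exact hb x hx
      _ = L * C ^ 2 := by rw [mul_pow, Real.sq_sqrt hL]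
  refine h.trans_eq ?_
  simp [hL]
  ring

theorem memH10.poincare {L : ℝ} (hL : 0 ≤ L) {f : ℝ → ℂ} (hf : memH10 L f) :
    L2norm L f ≤ L * L2norm L (deriv f) := by
  refine L2norm_le_of_norm_le hL (L2norm_nonneg _ _) fun x hx => ?_
  simpa [hf.2.1] using hf.1.norm_sub_le (Ioo_subset_Icc_self hx) (left_mem_Icc.2 hL)

theorem memH1star.poincare {L : ℝ} (hL : 0 < L) {f : ℝ → ℂ} (hf : memH1star L f) :
    L2norm L f ≤ L * L2norm L (deriv f) := by
  refine L2norm_le_of_norm_le hL.le (L2norm_nonneg _ _) fun x hx => ?_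
  have hmean : (∫ y in Ioo 0 L, f y) = 0 := hf.2
  have h1 : ∫ y in Ioo 0 L, (f x - f y) = L * f x := by
    rw [integral_sub (integrable_const _) hf.1.2.2.1.integrable, hmean]
    simp [hL.le]
  have h2 := norm_setIntegral_le_of_norm_le_const (μ := volume) (s := Ioo 0 L) (by simp)
    fun y hy => hf.1.norm_sub_le (Ioo_subset_Icc_self hx) (Ioo_subset_Icc_self hy)
  rw [h1, norm_mul, Complex.norm_real, Real.norm_of_nonneg hL.le, mul_comm] at h2
  simp only [measureReal_def, Real.volume_Ioo, sub_zero, ENNReal.toReal_ofReal hL.le] at h2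
  exact le_of_mul_le_mul_right h2 hL

theorem MnormSq_nonneg {L : ℝ} {w : ℝ → ℝ} (hw : ∀ s ∈ Ioi (0 : ℝ), 0 ≤ w s)
    (η : ℝ → ℝ → ℂ) : 0 ≤ MnormSq L w η :=
  setIntegral_nonneg measurableSet_Ioi fun s hs => mul_nonneg (hw s hs) (L2normSq_nonneg _ _)

theorem memH1.integral_deriv_mul_conj {L : ℝ} (hL : 0 ≤ L) {A u : ℝ → ℂ} (hA : memH1 L A)
    (hu : memH1 L u) (h0 : A 0 * u 0 = 0) (h1 : A L * u L = 0) :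
    IntegrableOn (fun x => deriv A x * (starRingEnd ℂ) (u x) +
      A x * (starRingEnd ℂ) (deriv u x)) (Ioo 0 L) ∧
    ∫ x in Ioo 0 L, (deriv A x * (starRingEnd ℂ) (u x) +
      A x * (starRingEnd ℂ) (deriv u x)) = 0 := by
  have hi : IntegrableOn (fun x => deriv A x * (starRingEnd ℂ) (u x) +
      A x * (starRingEnd ℂ) (deriv u x)) (Ioo 0 L) :=
    (hA.2.2.2.integrable_mul hu.2.2.1.conj).add (hA.2.2.1.integrable_mul hu.2.2.2.conj)
  refine ⟨hi, ?_⟩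
  refine (integral_Ioo_eq_sub (F := fun x => A x * (starRingEnd ℂ) (u x)) hL
    (hA.1.mul (Complex.continuous_conj.comp_continuousOn hu.1))
    (fun x hx => (hA.2.1 x hx).hasDerivAt.mul (hu.2.1 x hx).hasDerivAt.star) hi).trans ?_
  have e : ∀ z w : ℂ, z * w = 0 → z * (starRingEnd ℂ) w = 0 := by simp
  rw [e _ _ h0, e _ _ h1, sub_zero]

theorem velocity_pointwise {r1 r2 k b c d lam : ℝ} (hr1 : 0 ≤ r1) (hr2 : 0 ≤ r2) (hk : 0 ≤ k)
    (hb : 0 ≤ b) (hc : 0 ≤ c) (hd : 0 ≤ d) (phi' phi Phi psi' psi Psi theta xi f g F G S : ℂ)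
    (hf : f = Complex.I * lam * phi - Phi) (hg : g = Complex.I * lam * psi - Psi)
    (hS : S = r1 * (Complex.I * lam * Phi - F) * (starRingEnd ℂ) phi +
        (k * (phi' + psi) - c * theta) * (starRingEnd ℂ) phi' +
        ((r2 * (Complex.I * lam * Psi - G) + (k * (phi' + psi) - c * theta)) *
            (starRingEnd ℂ) psi +
          (b * psi' - d * xi) * (starRingEnd ℂ) psi')) :
    r1 * ‖Phi‖ ^ 2 + r2 * ‖Psi‖ ^ 2 ≤
      k * (‖phi' + psi‖ * ‖phi' + psi‖) + c * (‖theta‖ * ‖phi' + psi‖) +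
      b * (‖psi'‖ * ‖psi'‖) + d * (‖xi‖ * ‖psi'‖) + r1 * (‖Phi‖ * ‖f‖) + r2 * (‖Psi‖ * ‖g‖) +
      r1 * (‖F‖ * ‖phi‖) + r2 * (‖G‖ * ‖psi‖) -
      S.re := by
  set E : ℂ := k * ((phi' + psi) * (starRingEnd ℂ) (phi' + psi)) -
    c * (theta * (starRingEnd ℂ) (phi' + psi)) + b * (psi' * (starRingEnd ℂ) psi') -
    d * (xi * (starRingEnd ℂ) psi') - r1 * (Phi * (starRingEnd ℂ) f) -
    r2 * (Psi * (starRingEnd ℂ) g) - r1 * (F * (starRingEnd ℂ) phi) -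
    r2 * (G * (starRingEnd ℂ) psi) with hE
  have hES : ((r1 * ‖Phi‖ ^ 2 + r2 * ‖Psi‖ ^ 2 : ℝ) : ℂ) = E - S := by
    have e : ∀ z : ℂ, ((‖z‖ : ℝ) : ℂ) ^ 2 = z * (starRingEnd ℂ) z := fun z => by
      rw [Complex.mul_conj, Complex.normSq_eq_norm_sq]; push_cast; rfl
    push_cast
    rw [e, e, hE, hf, hg, hS]
    simp only [map_add, map_sub, map_mul, Complex.conj_I, Complex.conj_ofReal]
    ring
  have hre := congrArg Complex.re hES
  rw [Complex.ofReal_re, Complex.sub_re] at hre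
  have hn : ∀ (a : ℝ) (z w : ℂ), 0 ≤ a → ‖(a : ℂ) * (z * (starRingEnd ℂ) w)‖ = a * (‖z‖ * ‖w‖) := by
    intro a z w ha
    rw [norm_mul, norm_mul, Complex.norm_real, Real.norm_of_nonneg ha, RCLike.norm_conj]
  rw [hre, ← hn _ _ _ hk, ← hn _ _ _ hc, ← hn _ _ _ hb, ← hn _ _ _ hd, ← hn r1 Phi f hr1,
    ← hn r2 Psi g hr2, ← hn r1 F phi hr1, ← hn r2 G psi hr2]
  gcongr
  refine (Complex.re_le_norm E).trans ?_
  refine (norm_sub_le _ _).trans (add_le_add ?_ le_rfl)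
  refine (norm_sub_le _ _).trans (add_le_add ?_ le_rfl)
  refine (norm_sub_le _ _).trans (add_le_add ?_ le_rfl)
  refine (norm_sub_le _ _).trans (add_le_add ?_ le_rfl)
  refine (norm_sub_le _ _).trans (add_le_add ?_ le_rfl)
  refine (norm_add_le _ _).trans (add_le_add ?_ le_rfl)
  exact norm_sub_le _ _

/-- Regularity of `ψ, Ψ, θ`, vanishing boundary terms, and Poincaré inequalities for `ψ` and
`iλψ − Ψ`, under either kind of boundary conditions. -/
theorem memDomA.regularity_and_poincare {P : Params} {bc : BC} {U : State} (h : memDomA P bc U) (lam : ℝ) :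
    memH1 P.L U.psi ∧ memH1 P.L (deriv U.psi) ∧ memH1 P.L U.Psi ∧ memH1 P.L U.theta ∧
    deriv U.psi 0 * U.psi 0 = 0 ∧ deriv U.psi P.L * U.psi P.L = 0 ∧
    L2norm P.L U.psi ≤ P.L * L2norm P.L (deriv U.psi) ∧
    L2norm P.L ((Complex.I * (lam : ℂ)) • U.psi - U.Psi) ≤
      P.L * L2norm P.L (deriv ((Complex.I * (lam : ℂ)) • U.psi - U.Psi)) := by
  obtain ⟨⟨-, -, hH, -⟩, -, -, -, -, -, -, hD⟩ := h
  cases bc with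
  | mixed =>
    obtain ⟨hpsi, -⟩ := hH
    obtain ⟨hpsi', -, hPsi, htheta⟩ := hD
    exact ⟨hpsi.1, hpsi'.1, hPsi.1, htheta.1, by simp [hpsi'.2.1], by simp [hpsi'.2.2],
      hpsi.poincare P.hL, ((hpsi.const_smul _).sub hPsi).poincare P.hL⟩
  | dirichlet =>
    obtain ⟨hpsi, -⟩ := hH
    obtain ⟨hpsi2, hPsi, htheta, -⟩ := hD
    exact ⟨hpsi.1, hpsi2.2, hPsi.1, htheta.1, by simp [hpsi.2.1], by simp [hpsi.2.2],
      hpsi.poincare P.hL.le, ((hpsi.const_smul _).sub hPsi).poincare P.hL.le⟩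

theorem memHS.memL2_components {P : Params} {bc : BC} {U : State} (h : memHS P bc U) :
    memH10 P.L U.phi ∧ memL2 P.L U.Phi ∧ memH1 P.L U.psi ∧ memL2 P.L U.Psi := by
  obtain ⟨h1, h2, h3, -⟩ := h
  cases bc with
  | mixed => exact ⟨h1, h2, h3.1.1, h3.2.1⟩
  | dirichlet => exact ⟨h1, h2, h3.1.1, h3.2.1⟩

theorem hnormSq_nonneg (P : Params) (U : State) : 0 ≤ hnormSq P U := by
  have h1 := mul_nonneg P.hk.le (L2normSq_nonneg P.L (fun x => deriv U.phi x + U.psi x))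
  have h2 := mul_nonneg P.hrho1.le (L2normSq_nonneg P.L U.Phi)
  have h3 := mul_nonneg P.hb.le (L2normSq_nonneg P.L (deriv U.psi))
  have h4 := mul_nonneg P.hrho2.le (L2normSq_nonneg P.L U.Psi)
  have h5 := mul_nonneg P.hrho3.le (L2normSq_nonneg P.L U.theta)
  have h6 := mul_nonneg P.hrho4.le (L2normSq_nonneg P.L U.xi)
  have h7 := mul_nonneg P.hw1.le (MnormSq_nonneg (L := P.L) P.hmu_nonneg U.eta)
  have h8 := mul_nonneg P.hw2.le (MnormSq_nonneg (L := P.L) P.hnu_nonneg U.zeta)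
  unfold hnormSq
  linarith

theorem exists_L2norm_le_hnorm (P : Params) : ∃ K : ℝ, 0 < K ∧ ∀ U : State,
    L2norm P.L (fun x => deriv U.phi x + U.psi x) ≤ K * hnorm P U ∧
    L2norm P.L U.Phi ≤ K * hnorm P U ∧ L2norm P.L (deriv U.psi) ≤ K * hnorm P U ∧
    L2norm P.L U.Psi ≤ K * hnorm P U ∧ L2norm P.L U.theta ≤ K * hnorm P U ∧
    L2norm P.L U.xi ≤ K * hnorm P U := by
  have h1 := P.hk
  have h2 := P.hrho1
  have h3 := P.hb
  have h4 := P.hrho2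
  have h5 := P.hrho3
  have h6 := P.hrho4
  set C := 1 / P.k + 1 / P.rho1 + 1 / P.b + 1 / P.rho2 + 1 / P.rho3 + 1 / P.rho4
  have q1 : 0 < 1 / P.k := by positivity
  have q2 : 0 < 1 / P.rho1 := by positivity
  have q3 : 0 < 1 / P.b := by positivity
  have q4 : 0 < 1 / P.rho2 := by positivity
  have q5 : 0 < 1 / P.rho3 := by positivity
  have q6 : 0 < 1 / P.rho4 := by positivity
  refine ⟨Real.sqrt C, Real.sqrt_pos.2 (by positivity), fun U => ?_⟩
  have n1 := mul_nonneg h1.le (L2normSq_nonneg P.L (fun x => deriv U.phi x + U.psi x))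
  have n2 := mul_nonneg h2.le (L2normSq_nonneg P.L U.Phi)
  have n3 := mul_nonneg h3.le (L2normSq_nonneg P.L (deriv U.psi))
  have n4 := mul_nonneg h4.le (L2normSq_nonneg P.L U.Psi)
  have n5 := mul_nonneg h5.le (L2normSq_nonneg P.L U.theta)
  have n6 := mul_nonneg h6.le (L2normSq_nonneg P.L U.xi)
  have n7 := mul_nonneg P.hw1.le (MnormSq_nonneg (L := P.L) P.hmu_nonneg U.eta)
  have n8 := mul_nonneg P.hw2.le (MnormSq_nonneg (L := P.L) P.hnu_nonneg U.zeta)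
  have key : ∀ (a : ℝ) (f : ℝ → ℂ), 0 < a → 1 / a ≤ C → a * L2normSq P.L f ≤ hnormSq P U →
      L2norm P.L f ≤ Real.sqrt C * hnorm P U := by
    intro a f ha haC hle
    rw [hnorm, ← Real.sqrt_mul (by positivity)]
    refine Real.sqrt_le_sqrt ?_
    calc L2normSq P.L f = 1 / a * (a * L2normSq P.L f) := by field_simp
      _ ≤ C * hnormSq P U :=
        mul_le_mul haC hle (mul_nonneg ha.le (L2normSq_nonneg _ _)) (by positivity)
  refine ⟨key _ _ h1 ?_ ?_, key _ _ h2 ?_ ?_, key _ _ h3 ?_ ?_, key _ _ h4 ?_ ?_,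
    key _ _ h5 ?_ ?_, key _ _ h6 ?_ ?_⟩ <;> first | linarith | (unfold hnormSq; linarith)

/-- The integral inequality obtained by testing the momentum equations with `φ` and `ψ`. -/
theorem velocity_integral_estimate {P : Params} {bc : BC} {lam : ℝ} {U Uhat : State}
    (hU : memDomA P bc U) (hUhat : memHS P bc Uhat) (hres : resolventEq P lam U Uhat) :
    P.rho1 * L2normSq P.L U.Phi + P.rho2 * L2normSq P.L U.Psi ≤
      P.k * (L2norm P.L (fun x => deriv U.phi x + U.psi x) *
        L2norm P.L (fun x => deriv U.phi x + U.psi x)) +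
      P.gamma * (L2norm P.L U.theta * L2norm P.L (fun x => deriv U.phi x + U.psi x)) +
      P.b * (L2norm P.L (deriv U.psi) * L2norm P.L (deriv U.psi)) +
      P.sigma * (L2norm P.L U.xi * L2norm P.L (deriv U.psi)) +
      P.rho1 * (L2norm P.L U.Phi * L2norm P.L ((Complex.I * (lam : ℂ)) • U.phi - U.Phi)) +
      P.rho2 * (L2norm P.L U.Psi * L2norm P.L ((Complex.I * (lam : ℂ)) • U.psi - U.Psi)) +
      P.rho1 * (L2norm P.L Uhat.Phi * L2norm P.L U.phi) +
      P.rho2 * (L2norm P.L Uhat.Psi * L2norm P.L U.psi) := by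
  obtain ⟨hpsi, hpsi', hPsi, htheta, hb0, hbL, -, -⟩ := hU.regularity_and_poincare lam
  obtain ⟨⟨hphi, -⟩, hphi2, hPhi, hxi, -⟩ := hU
  obtain ⟨-, hFhat, -, hGhat⟩ := hUhat.memL2_components
  obtain ⟨-, hPhiEq, -, hPsiEq, -⟩ := hres
  set w : ℝ → ℂ := fun x => deriv U.phi x + U.psi x
  set f : ℝ → ℂ := (Complex.I * (lam : ℂ)) • U.phi - U.Phi
  set g : ℝ → ℂ := (Complex.I * (lam : ℂ)) • U.psi - U.Psi
  have hwH : memH1 P.L w := hphi2.2.add hpsi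
  set A : ℝ → ℂ := (P.k : ℂ) • w - (P.gamma : ℂ) • U.theta
  set B : ℝ → ℂ := (P.b : ℂ) • deriv U.psi - (P.sigma : ℂ) • U.xi with hB
  have hAH : memH1 P.L A := (hwH.const_smul _).sub (htheta.const_smul _)
  have hBH : memH1 P.L B := (hpsi'.const_smul _).sub (hxi.1.const_smul _)
  obtain ⟨hi1, hz1⟩ := hAH.integral_deriv_mul_conj P.hL.le hphi.1 (by simp [hphi.2.1])
    (by simp [hphi.2.2])
  obtain ⟨hi2, hz2⟩ := hBH.integral_deriv_mul_conj P.hL.le hpsi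
    (by simp [hB, hxi.2.1, mul_assoc, hb0]) (by simp [hB, hxi.2.2, mul_assoc, hbL])
  set S1 : ℝ → ℂ := fun x => deriv A x * (starRingEnd ℂ) (U.phi x) +
      A x * (starRingEnd ℂ) (deriv U.phi x)
  set S2 : ℝ → ℂ := fun x => deriv B x * (starRingEnd ℂ) (U.psi x) +
      B x * (starRingEnd ℂ) (deriv U.psi x)
  have hSi : IntegrableOn (fun x => (S1 x + S2 x).re) (Ioo 0 P.L) := (hi1.add hi2).re
  have hSz : ∫ x in Ioo 0 P.L, (S1 x + S2 x).re = 0 := by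
    have h := integral_re (𝕜 := ℂ) (hi1.add hi2)
    simp only [Pi.add_apply] at h
    rw [integral_add hi1 hi2, hz1, hz2] at h
    simpa using h
  have dk : (P.rho1 : ℂ) ≠ 0 := by exact_mod_cast P.hrho1.ne'
  have dk2 : (P.rho2 : ℂ) ≠ 0 := by exact_mod_cast P.hrho2.ne'
  have hf2 : memL2 P.L f := ((hphi.1.const_smul _).sub hPhi.1).2.2.1
  have hg2 : memL2 P.L g := ((hpsi.const_smul _).sub hPsi).2.2.1
  obtain ⟨hRi, hR⟩ := (((((((integralBound_norm_mul P.hk.le hwH.2.2.1 hwH.2.2.1).add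
    (integralBound_norm_mul P.hgamma.le htheta.2.2.1 hwH.2.2.1)).add
    (integralBound_norm_mul P.hb.le hpsi'.2.2.1 hpsi'.2.2.1)).add
    (integralBound_norm_mul P.hsigma.le hxi.1.2.2.1 hpsi'.2.2.1)).add
    (integralBound_norm_mul P.hrho1.le hPhi.1.2.2.1 hf2)).add
    (integralBound_norm_mul P.hrho2.le hPsi.2.2.1 hg2)).add
    (integralBound_norm_mul P.hrho1.le hFhat hphi.1.2.2.1)).add
    (integralBound_norm_mul P.hrho2.le hGhat hpsi.2.2.1)
  have hpt : ∀ᵐ x ∂(volume.restrict (Ioo 0 P.L)),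
      P.rho1 * ‖U.Phi x‖ ^ 2 + P.rho2 * ‖U.Psi x‖ ^ 2 ≤
        P.k * (‖w x‖ * ‖w x‖) + P.gamma * (‖U.theta x‖ * ‖w x‖) +
        P.b * (‖deriv U.psi x‖ * ‖deriv U.psi x‖) + P.sigma * (‖U.xi x‖ * ‖deriv U.psi x‖) +
        P.rho1 * (‖U.Phi x‖ * ‖f x‖) + P.rho2 * (‖U.Psi x‖ * ‖g x‖) +
        P.rho1 * (‖Uhat.Phi x‖ * ‖U.phi x‖) + P.rho2 * (‖Uhat.Psi x‖ * ‖U.psi x‖) -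
        (S1 x + S2 x).re := by
    filter_upwards [hPhiEq, hPsiEq, ae_restrict_mem measurableSet_Ioo] with x hx1 hx2 hx
    change Complex.I * (lam : ℂ) * U.Phi x -
      (((P.k / P.rho1 : ℝ) : ℂ) * deriv w x - ((P.gamma / P.rho1 : ℝ) : ℂ) * deriv U.theta x) =
        Uhat.Phi x at hx1
    change Complex.I * (lam : ℂ) * U.Psi x -
      (((P.b / P.rho2 : ℝ) : ℂ) * deriv (deriv U.psi) x - ((P.k / P.rho2 : ℝ) : ℂ) * w x +
        ((P.gamma / P.rho2 : ℝ) : ℂ) * U.theta x - ((P.sigma / P.rho2 : ℝ) : ℂ) * deriv U.xi x) =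
        Uhat.Psi x at hx2
    have hdA : deriv A x = P.k * deriv w x - P.gamma * deriv U.theta x :=
      (((hwH.2.1 x hx).hasDerivAt.const_smul (P.k : ℂ)).sub
        ((htheta.2.1 x hx).hasDerivAt.const_smul (P.gamma : ℂ))).deriv
    have hdB : deriv B x = P.b * deriv (deriv U.psi) x - P.sigma * deriv U.xi x :=
      (((hpsi'.2.1 x hx).hasDerivAt.const_smul (P.b : ℂ)).sub
        ((hxi.1.2.1 x hx).hasDerivAt.const_smul (P.sigma : ℂ))).deriv
    have hA1 : deriv A x = P.rho1 * (Complex.I * lam * U.Phi x - Uhat.Phi x) := by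
      rw [hdA, ← hx1]
      push_cast
      field_simp
      ring
    have hB1 : deriv B x = P.rho2 * (Complex.I * lam * U.Psi x - Uhat.Psi x) +
        (P.k * (deriv U.phi x + U.psi x) - P.gamma * U.theta x) := by
      rw [hdB, ← hx2]
      push_cast
      field_simp
      ring
    have hp := velocity_pointwise (lam := lam) P.hrho1.le P.hrho2.le P.hk.le P.hb.le P.hgamma.le
      P.hsigma.le (deriv U.phi x) (U.phi x) (U.Phi x) (deriv U.psi x) (U.psi x) (U.Psi x)
      (U.theta x) (U.xi x) (f x) (g x) (Uhat.Phi x) (Uhat.Psi x) (S1 x + S2 x) rfl rfl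
      (by rw [← hA1, ← hB1]; rfl)
    exact hp
  have hlhs : P.rho1 * L2normSq P.L U.Phi + P.rho2 * L2normSq P.L U.Psi =
      ∫ x in Ioo 0 P.L, (P.rho1 * ‖U.Phi x‖ ^ 2 + P.rho2 * ‖U.Psi x‖ ^ 2) := by
    rw [integral_add (hPhi.1.2.2.1.2.const_mul _) (hPsi.2.2.1.2.const_mul _),
      integral_const_mul, integral_const_mul]
    rfl
  rw [hlhs]
  refine (integral_mono_ae ((hPhi.1.2.2.1.2.const_mul _).add (hPsi.2.2.1.2.const_mul _))
    (hRi.sub hSi) hpt).trans ?_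
  rw [integral_sub' hRi hSi, hSz, sub_zero]
  exact hR

/-- **Lemma 4.5.** If `U ∈ D(𝒜)` satisfies the resolvent equation
`iλU − 𝒜U = Û` and `ε ∈ (0,1)`, then
`ρ1‖Φ‖² + ρ2‖Ψ‖² ≤ cε‖U‖²_ℋ + c‖U‖_ℋ[‖φx+ψ‖+‖ψx‖] + (c/ε³)‖U‖_ℋ‖Û‖_ℋ`
for some structural constant `c > 0` independent of `λ`, `ε`, `U`, `Û`. -/
theorem velocity_estimate (P : Params) (bc : BC) :
    ∃ c : ℝ, 0 < c ∧ ∀ (lam : ℝ) (eps : ℝ), eps ∈ Ioo (0 : ℝ) 1 →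
      ∀ (U Uhat : State),
        memDomA P bc U → memHS P bc Uhat → resolventEq P lam U Uhat →
        P.rho1 * L2normSq P.L U.Phi + P.rho2 * L2normSq P.L U.Psi ≤
          c * eps * hnormSq P U +
          c * hnorm P U *
            (L2norm P.L (fun x => deriv U.phi x + U.psi x) +
              L2norm P.L (deriv U.psi)) +
          (c / eps ^ 3) * hnorm P U * hnorm P Uhat := by
  obtain ⟨K, hK, hKb⟩ := exists_L2norm_le_hnorm P
  have hL := P.hL
  have p1 := P.hk
  have p2 := P.hgamma
  have p3 := P.hb
  have p4 := P.hsigma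
  have p5 := P.hrho1
  have p6 := P.hrho2
  refine ⟨(P.k + P.gamma + P.b + P.sigma) * K +
    2 * K ^ 2 * (P.rho1 * (P.L * (1 + P.L)) + P.rho2 * P.L), by positivity, ?_⟩
  intro lam eps heps U Uhat hU hUhat hres
  obtain ⟨b1, b2, b3, b4, b5, b6⟩ := hKb U
  obtain ⟨c1, c2, c3, c4, -, -⟩ := hKb Uhat
  have hmain := velocity_integral_estimate hU hUhat hres
  obtain ⟨hpsi, hpsi', hPsi, -, -, -, hq1, hq2⟩ := hU.regularity_and_poincare lam
  obtain ⟨⟨hphi, -⟩, hphi2, hPhi, -⟩ := hU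
  obtain ⟨hfEq, -, hgEq, -⟩ := hres
  have hfH : memH10 P.L ((Complex.I * (lam : ℂ)) • U.phi - U.Phi) := (hphi.const_smul _).sub hPhi
  have hgH : memH1 P.L ((Complex.I * (lam : ℂ)) • U.psi - U.Psi) := (hpsi.const_smul _).sub hPsi
  have hphiP := hphi.poincare hL.le
  have hfP := hfH.poincare hL.le
  have ht1 := L2norm_le_add_of_add hphi.1.2.2.2 hpsi.2.2.1
  have ht2 := L2norm_le_add_of_add hfH.1.2.2.2 hgH.2.2.1
  have e1 := L2norm_congr hfEq
  have e2 := L2norm_congr hgEq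
  change L2norm P.L (deriv ((Complex.I * (lam : ℂ)) • U.phi - U.Phi) +
    ((Complex.I * (lam : ℂ)) • U.psi - U.Psi)) = _ at e1
  change L2norm P.L (deriv ((Complex.I * (lam : ℂ)) • U.psi - U.Psi)) = _ at e2
  rw [e1] at ht2
  rw [e2] at hq2
  change L2norm P.L (deriv U.phi) ≤
    L2norm P.L (fun x => deriv U.phi x + U.psi x) + L2norm P.L U.psi at ht1
  have hN : 0 ≤ hnorm P U := Real.sqrt_nonneg _
  have hM : 0 ≤ hnorm P Uhat := Real.sqrt_nonneg _
  have hNsq := hnormSq_nonneg P U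
  set a := L2norm P.L (fun x => deriv U.phi x + U.psi x)
  set p := L2norm P.L (deriv U.psi)
  set N := hnorm P U
  set M := hnorm P Uhat
  have ha : 0 ≤ a := L2norm_nonneg _ _
  have hp : 0 ≤ p := L2norm_nonneg _ _
  have hPsiB : L2norm P.L U.psi ≤ P.L * (K * N) := hq1.trans (by gcongr)
  have hgB : L2norm P.L ((Complex.I * (lam : ℂ)) • U.psi - U.Psi) ≤ P.L * (K * M) :=
    hq2.trans (by gcongr)
  have hphiB : L2norm P.L U.phi ≤ P.L * (K * N + P.L * (K * N)) :=
    hphiP.trans (by gcongr; linarith)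
  have hfB : L2norm P.L ((Complex.I * (lam : ℂ)) • U.phi - U.Phi) ≤
      P.L * (K * M + P.L * (K * M)) :=
    hfP.trans (by gcongr; linarith)
  set c := (P.k + P.gamma + P.b + P.sigma) * K +
    2 * K ^ 2 * (P.rho1 * (P.L * (1 + P.L)) + P.rho2 * P.L)
  have hc0 : 0 ≤ c := by positivity
  have hceps : c ≤ c / eps ^ 3 := by
    have := heps.1
    exact le_div_self hc0 (by positivity) (pow_le_one₀ heps.1.le heps.2.le)
  have hnn := L2norm_nonneg P.L
  calc P.rho1 * L2normSq P.L U.Phi + P.rho2 * L2normSq P.L U.Psi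
      ≤ P.k * ((K * N) * a) + P.gamma * ((K * N) * a) + P.b * ((K * N) * p) +
        P.sigma * ((K * N) * p) + P.rho1 * ((K * N) * (P.L * (K * M + P.L * (K * M)))) +
        P.rho2 * ((K * N) * (P.L * (K * M))) +
        P.rho1 * ((K * M) * (P.L * (K * N + P.L * (K * N)))) +
        P.rho2 * ((K * M) * (P.L * (K * N))) := by
        refine hmain.trans ?_
        gcongr <;> apply hnn
    _ = (P.k + P.gamma) * K * (N * a) + (P.b + P.sigma) * K * (N * p) +
        2 * K ^ 2 * (P.rho1 * (P.L * (1 + P.L)) + P.rho2 * P.L) * (N * M) := by ring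
    _ ≤ c * (N * a) + c * (N * p) + c * (N * M) := by
        gcongr
        · have : 0 ≤ (P.b + P.sigma) * K +
            2 * K ^ 2 * (P.rho1 * (P.L * (1 + P.L)) + P.rho2 * P.L) := by positivity
          linarith
        · have : 0 ≤ (P.k + P.gamma) * K +
            2 * K ^ 2 * (P.rho1 * (P.L * (1 + P.L)) + P.rho2 * P.L) := by positivity
          linarith
        · have : 0 ≤ (P.k + P.gamma + P.b + P.sigma) * K := by positivity
          linarith
    _ ≤ 0 + (c * (N * a) + c * (N * p)) + c / eps ^ 3 * (N * M) := by
        rw [zero_add]; gcongr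
    _ ≤ c * eps * hnormSq P U + (c * (N * a) + c * (N * p)) + c / eps ^ 3 * (N * M) := by
        have := mul_nonneg (mul_nonneg hc0 heps.1.le) hNsq
        gcongr
    _ = c * eps * hnormSq P U + c * N * (a + p) + c / eps ^ 3 * N * M := by ring

end TGP
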